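/- Let q be an odd prime power with q ≡ 3 (mod 4), q > 7, q ≠ 27, and d = (q-3)/2. Suppose 5 is a nonsquare in F_q, and let λ = ∑_{x∈F_q} χ(x(x²+4x-1)) + ∑_{x∈F_q} χ(x(x²-2x+5)). For i ∈ {0,1,2}, let ω_i = |{b ∈ F_q : |{x ∈ F_q : (x+1)^d - x^d = b}| = i}|. Then ω₀ = (q + λ - 7)/4, ω₁ = (q - λ + 7)/2, ω₂ = (q + λ - 7)/4, and ω₀ + ω₁ + ω₂ = q. -/

import Mathlib

open Finset

section CharacterSums
variable {F : Type*} [Field F] [Fintype F] [DecidableEq F]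

/-- The number of roots of a monic quadratic, in terms of its discriminant. -/
lemma card_filter_monic_quadratic (hF : ringChar F ≠ 2) (u c : F) :
    (#{x : F | x ^ 2 - u * x + c = 0} : ℤ) = 1 + quadraticChar F (u ^ 2 - 4 * c) := by
  have h2 : (2 : F) ≠ 0 := Ring.two_ne_zero hF
  rw [add_comm, ← quadraticChar_card_sqrts hF]
  norm_cast
  refine card_bij' (fun x _ => 2 * x - u) (fun y _ => (y + u) / 2) ?_ ?_ ?_ ?_
  · intro x hx
    simp only [mem_filter, mem_univ, true_and, Set.mem_toFinset, Set.mem_ofPred_eq] at hx ⊢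
    linear_combination 4 * hx
  · intro y hy
    simp only [mem_filter, mem_univ, true_and, Set.mem_toFinset, Set.mem_ofPred_eq] at hy ⊢
    field_simp
    linear_combination hy
  · intro x _
    field_simp
    ring
  · intro y _
    field_simp
    ring

/-- Change of variables `u = x + c / x` in a sum over the nonzero elements. -/
lemma sum_comp_add_mul_inv (hF : ringChar F ≠ 2) {c : F} (hc : c ≠ 0) (φ : F → ℤ) :
    ∑ x : F with x ≠ 0, φ (x + c * x⁻¹) =
      ∑ u : F, φ u * (1 + quadraticChar F (u ^ 2 - 4 * c)) := by
  rw [← sum_fiberwise_of_maps_to (g := fun x : F => x + c * x⁻¹) (t := univ)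
    (fun x _ => mem_univ _)]
  refine sum_congr rfl fun u _ => ?_
  rw [← card_filter_monic_quadratic hF, sum_congr rfl (g := fun _ => φ u)
    (fun x hx => by rw [(mem_filter.mp hx).2]), sum_const, nsmul_eq_mul, mul_comm, filter_filter]
  congr 3
  refine filter_congr fun x _ => ?_
  constructor
  · rintro ⟨hx, rfl⟩
    field_simp
    ring
  · intro h
    have hx : x ≠ 0 := by
      rintro rfl
      exact hc (by linear_combination h)
    refine ⟨hx, ?_⟩
    field_simp
    linear_combination h

lemma sum_quadraticChar_sq_sub (hF : ringChar F ≠ 2) {c : F} (hc : c ≠ 0) :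
    ∑ u : F, quadraticChar F (u ^ 2 - 4 * c) = -1 := by
  have h := sum_comp_add_mul_inv hF hc (fun _ => 1)
  have hcard : #{x : F | x ≠ 0} = Fintype.card F - 1 := by
    rw [filter_ne', card_erase_of_mem (mem_univ _), card_univ]
  have hpos : 0 < Fintype.card F := Fintype.card_pos
  simp only [sum_const, one_mul, sum_add_distrib, hcard, card_univ, nsmul_eq_mul, mul_one] at h
  omega

/-- Equality of the character sums attached to two 2-isogenous cubics. -/
lemma sum_quadraticChar_two_isogeny (hF : ringChar F ≠ 2) (a : F) {c : F} (hc : c ≠ 0) :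
    ∑ x : F, quadraticChar F (x * (x ^ 2 + a * x + c)) =
      ∑ u : F, quadraticChar F ((u + a) * (u ^ 2 - 4 * c)) := by
  have h := sum_comp_add_mul_inv hF hc (fun u => quadraticChar F (u + a))
  have hs : ∑ u : F, quadraticChar F (u + a) = 0 := by
    rw [← quadraticChar_sum_zero hF]
    exact Equiv.sum_comp (Equiv.addRight a) (fun u => quadraticChar F u)
  simp only [mul_add, mul_one, sum_add_distrib, hs, zero_add, ← map_mul] at h
  rw [← h, sum_filter]
  refine sum_congr rfl fun x _ => ?_
  split_ifs with hx
  · rw [← one_mul (quadraticChar F (x + _ + a)), ← quadraticChar_sq_one' hx, ← map_mul]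
    congr 1
    field_simp
    ring
  · simp [not_not.mp hx]

lemma sum_quadraticChar_mul_add (hF : ringChar F ≠ 2) {c : F} (hc : c ≠ 0) :
    ∑ x : F, quadraticChar F (x * (x + c)) = -1 := by
  have h2 : (2 : F) ≠ 0 := Ring.two_ne_zero hF
  have hc' : (c / 4) ^ 2 ≠ 0 := by
    have : (4 : F) = 2 * 2 := by norm_num
    rw [this]
    positivity
  rw [← sum_quadraticChar_sq_sub hF hc', ← Equiv.sum_comp (Equiv.addRight (c / 2))
    (fun u => quadraticChar F (u ^ 2 - _))]
  refine sum_congr rfl fun x _ => ?_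
  congr 1
  have : (4 : F) = 2 * 2 := by norm_num
  simp only [Equiv.coe_addRight, this]
  field_simp
  ring

/-- Inversion `b = 4 / t` in a quartic character sum. -/
lemma sum_quadraticChar_quartic (hF : ringChar F ≠ 2) :
    ∑ b : F, quadraticChar F (b * (b + 4) * (b ^ 2 + 4)) =
      ∑ x : F, quadraticChar F (x * (x ^ 2 - 2 * x + 5)) - 1 := by
  have h2 : (2 : F) ≠ 0 := Ring.two_ne_zero hF
  have h4 : (4 : F) ≠ 0 := by
    have : (4 : F) = 2 * 2 := by norm_num
    rw [this]
    exact mul_ne_zero h2 h2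
  have hinv : ∑ b : F, quadraticChar F (b * (b + 4) * (b ^ 2 + 4)) =
      ∑ t : F, (quadraticChar F ((t + 1) * (t ^ 2 + 4)) - if t = 0 then 1 else 0) := by
    rw [← Equiv.sum_comp ((Equiv.inv F).trans (Equiv.mulLeft₀ 4 h4))]
    refine sum_congr rfl fun t _ => ?_
    split_ifs with ht
    · have : quadraticChar F 4 = 1 := by
        rw [← quadraticChar_sq_one' h2]
        norm_num
      simp [ht, this]
    · have h8 : (8 / t ^ 2 : F) ≠ 0 := by
        have : (8 : F) = 2 * 4 := by norm_num
        rw [this]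
        exact div_ne_zero (mul_ne_zero h2 h4) (pow_ne_zero _ ht)
      rw [sub_zero, ← one_mul (quadraticChar F ((t + 1) * _)), ← quadraticChar_sq_one' h8,
        ← map_mul]
      congr 1
      simp only [Equiv.trans_apply, Equiv.inv_apply, Equiv.mulLeft₀_apply]
      field_simp
      ring
  rw [hinv, sum_sub_distrib, sum_ite_eq' univ (0 : F), if_pos (mem_univ _),
    ← Equiv.sum_comp (Equiv.addRight (1 : F)) (fun x => quadraticChar F (x * _))]
  congr 1
  refine sum_congr rfl fun x _ => ?_
  congr 1
  simp only [Equiv.coe_addRight]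
  ring

end CharacterSums

section Fibres
variable {F : Type*} [Field F] [Fintype F] [DecidableEq F]

/-- The difference function of `x ↦ χ(x) / x`, with `χ` the quadratic character. -/
def chiInvDiff (x : F) : F :=
  (quadraticChar F (x + 1) : F) * (x + 1)⁻¹ - (quadraticChar F x : F) * x⁻¹

lemma pow_half_card_sub_three (hF : ringChar F ≠ 2) (hq : 7 < Fintype.card F) (x : F) :
    x ^ ((Fintype.card F - 3) / 2) = (quadraticChar F x : F) * x⁻¹ := by
  have hodd := FiniteField.odd_card_of_char_ne_two hF
  have he : Fintype.card F / 2 = (Fintype.card F - 3) / 2 + 1 := by omega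
  rw [quadraticChar_eq_pow_of_char_ne_two' hF, he]
  rcases eq_or_ne x 0 with rfl | hx
  · rw [zero_pow (by omega)]
    simp
  · rw [pow_succ, mul_inv_cancel_right₀ hx]

lemma quadraticChar_neg (hneg : quadraticChar F (-1) = -1) (x : F) :
    quadraticChar F (-x) = -quadraticChar F x := by
  rw [neg_eq_neg_one_mul, map_mul, hneg, neg_one_mul]

lemma quadraticChar_neg_one_sub (hneg : quadraticChar F (-1) = -1) (x : F) :
    quadraticChar F (-1 - x) = -quadraticChar F (x + 1) := by
  rw [← quadraticChar_neg hneg, neg_add_rev, sub_eq_add_neg]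

lemma quadraticChar_neg_one_sub_add_one (hneg : quadraticChar F (-1) = -1) (x : F) :
    quadraticChar F (-1 - x + 1) = -quadraticChar F x := by
  rw [← quadraticChar_neg hneg]
  congr 1
  ring

lemma sq_add_four_ne_zero (hF : ringChar F ≠ 2) (hneg : quadraticChar F (-1) = -1) {b : F}
    (hb : b ≠ 0) : b ^ 2 + 4 ≠ 0 := by
  intro h
  have h' : b ^ 2 = -2 ^ 2 := by linear_combination h
  have := congrArg (quadraticChar F) h'
  rw [quadraticChar_neg hneg, quadraticChar_sq_one' (Ring.two_ne_zero hF),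
    quadraticChar_sq_one' hb] at this
  norm_num at this

lemma add_four_ne_zero (hF : ringChar F ≠ 2) (hneg : quadraticChar F (-1) = -1) {b : F}
    (hb : quadraticChar F b = 1) : b + 4 ≠ 0 := by
  intro h
  have h' : b = -2 ^ 2 := by linear_combination h
  rw [h', quadraticChar_neg hneg, quadraticChar_sq_one' (Ring.two_ne_zero hF)] at hb
  norm_num at hb

lemma quadraticChar_eq_of_mul_eq_one {x y : F} (h : quadraticChar F (x * y) = 1) :
    quadraticChar F x = quadraticChar F y := by
  rw [map_mul] at h
  rcases Int.mul_eq_one_iff_eq_one_or_neg_one.mp h with h | h <;> simp [h]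

lemma quadraticChar_eq_neg_of_mul_eq_neg_one {x y : F} (h : quadraticChar F (x * y) = -1) :
    quadraticChar F x = -quadraticChar F y := by
  rw [map_mul] at h
  rcases Int.mul_eq_neg_one_iff_eq_one_or_neg_one.mp h with h | h <;> simp [h]

lemma chiInvDiff_neg_one_sub (hneg : quadraticChar F (-1) = -1) (x : F) :
    chiInvDiff (-1 - x) = -chiInvDiff x := by
  have h1 : (-1 - x + 1 : F) = -x := by ring
  have h2 : (-1 - x : F) = -(x + 1) := by ring
  simp only [chiInvDiff, h1]
  rw [h2, quadraticChar_neg hneg, quadraticChar_neg hneg, inv_neg, inv_neg]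
  push_cast
  ring

lemma card_fibre_neg (hneg : quadraticChar F (-1) = -1) (b : F) :
    #{x : F | chiInvDiff x = -b} = #{x : F | chiInvDiff x = b} := by
  refine card_bij' (fun x _ => -1 - x) (fun x _ => -1 - x) ?_ ?_ ?_ ?_ <;> intro x hx <;>
    simp only [mem_filter, mem_univ, true_and, chiInvDiff_neg_one_sub hneg] at hx ⊢
  · rw [hx, neg_neg]
  · rw [hx]
  · ring
  · ring

/-- `χ(x) = χ(x + 1) = 1` contributes nothing to the fibre over a nonzero square `b`, and
`χ(x) = χ(x + 1) = -1` contributes the roots of `b x (x + 1) = 1`. -/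
lemma mem_fibre_same_iff (hneg : quadraticChar F (-1) = -1) {b : F}
    (hb : quadraticChar F b = 1) (x : F) :
    (chiInvDiff x = b ∧ quadraticChar F x * quadraticChar F (x + 1) = 1) ↔
      b * (x * (x + 1)) = 1 ∧ quadraticChar F x = -1 := by
  constructor
  · rintro ⟨h, hχ⟩
    have hx : x ≠ 0 := by rintro rfl; simp at hχ
    have hx1 : x + 1 ≠ 0 := by intro h0; simp [h0] at hχ
    rcases Int.mul_eq_one_iff_eq_one_or_neg_one.mp hχ with ⟨h1, h2⟩ | ⟨h1, h2⟩
    · exfalso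
      simp only [chiInvDiff, h1, h2] at h
      have hm : b * (x * (x + 1)) = -1 := by
        rw [← h]
        field_simp
        ring
      have := congrArg (quadraticChar F) hm
      rw [map_mul, map_mul, hb, h1, h2, hneg] at this
      norm_num at this
    · refine ⟨?_, h1⟩
      simp only [chiInvDiff, h1, h2] at h
      rw [← h]
      field_simp
      push_cast
      ring
  · rintro ⟨h, hχ⟩
    have hx : x ≠ 0 := by rintro rfl; simp at h
    have hx1 : x + 1 ≠ 0 := by intro h0; simp [h0] at h
    have h1 := congrArg (quadraticChar F) h
    rw [map_mul, hb, one_mul, map_one] at h1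
    have h2 := quadraticChar_eq_of_mul_eq_one h1
    refine ⟨?_, by rw [← map_mul, h1]⟩
    rw [chiInvDiff, ← h2, hχ]
    push_cast
    field_simp
    linear_combination -h

lemma card_fibre_same (hF : ringChar F ≠ 2) (hneg : quadraticChar F (-1) = -1) {b : F}
    (hb : quadraticChar F b = 1) :
    #{x : F | chiInvDiff x = b ∧ quadraticChar F x * quadraticChar F (x + 1) = 1} =
      if quadraticChar F (b + 4) = 1 then 1 else 0 := by
  have h2 : (2 : F) ≠ 0 := Ring.two_ne_zero hF
  have hb0 : b ≠ 0 := by rintro rfl; simp at hb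
  simp only [mem_fibre_same_iff hneg hb]
  split_ifs with h4
  · have hb4 : b + 4 ≠ 0 := by intro h; simp [h] at h4
    obtain ⟨r, hr⟩ := (quadraticChar_one_iff_isSquare hb0).mp hb
    obtain ⟨t, ht⟩ := (quadraticChar_one_iff_isSquare hb4).mp h4
    have hr0 : r ≠ 0 := by rintro rfl; simp [hr] at hb0
    have hroot : ∃ y : F, b * (y * (y + 1)) = 1 := by
      refine ⟨(t / r - 1) / 2, ?_⟩
      field_simp
      linear_combination (b + 4) * hr - b * ht
    obtain ⟨y, hy⟩ := hroot
    have hχ : quadraticChar F y = quadraticChar F (y + 1) := by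
      apply quadraticChar_eq_of_mul_eq_one
      have h1 := congrArg (quadraticChar F) hy
      rwa [map_mul, hb, one_mul, map_one] at h1
    have hex : ∃ z : F, b * (z * (z + 1)) = 1 ∧ quadraticChar F z = -1 := by
      have hy0 : y ≠ 0 := by rintro rfl; simp at hy
      rcases quadraticChar_dichotomy hy0 with h | h
      · exact ⟨-1 - y, by linear_combination hy, by rw [quadraticChar_neg_one_sub hneg, ← hχ, h]⟩
      · exact ⟨y, hy, h⟩
    obtain ⟨z, hz, hzχ⟩ := hex
    rw [card_eq_one]
    refine ⟨z, ?_⟩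
    ext x
    simp only [mem_filter, mem_univ, true_and, mem_singleton]
    refine ⟨?_, by rintro rfl; exact ⟨hz, hzχ⟩⟩
    rintro ⟨hx, hxχ⟩
    have hprod : (x - z) * (x + z + 1) = 0 := by
      apply mul_left_cancel₀ hb0
      linear_combination hx - hz
    rcases mul_eq_zero.mp hprod with h | h
    · exact sub_eq_zero.mp h
    · exfalso
      have hxz : x = -1 - z := by linear_combination h
      have h1 := congrArg (quadraticChar F) hz
      rw [map_mul, hb, one_mul, map_one] at h1
      rw [hxz, quadraticChar_neg_one_sub hneg, ← quadraticChar_eq_of_mul_eq_one h1, hzχ] at hxχ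
      norm_num at hxχ
  · rw [card_eq_zero, filter_eq_empty_iff]
    rintro x - ⟨hx, -⟩
    apply h4
    have hsq : b * (b + 4) = (b * (2 * x + 1)) ^ 2 := by linear_combination -4 * b * hx
    have hb4 : b + 4 ≠ 0 := add_four_ne_zero hF hneg hb
    have hne : b * (2 * x + 1) ≠ 0 := by
      intro h
      rw [h] at hsq
      exact mul_ne_zero hb0 hb4 (by simpa using hsq)
    rw [← one_mul (quadraticChar F _), ← hb, ← map_mul, hsq, quadraticChar_sq_one' hne, hb]

/-- The mixed part of the fibre over `b`, `χ(x + 1) = -χ(x) ≠ 0`, in polynomial form. -/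
lemma mem_fibre_mixed_iff (b x : F) :
    (chiInvDiff x = b ∧ quadraticChar F x * quadraticChar F (x + 1) = -1) ↔
      (b * (x * (x + 1)) = 2 * x + 1 ∧ quadraticChar F x = -1 ∧ quadraticChar F (x + 1) = 1) ∨
      (b * (x * (x + 1)) = -(2 * x + 1) ∧ quadraticChar F x = 1 ∧
        quadraticChar F (x + 1) = -1) := by
  have key (ε : ℤ) (h0 : x ≠ 0) (h1 : x + 1 ≠ 0) (hx : quadraticChar F x = -ε)
      (hx1 : quadraticChar F (x + 1) = ε) :
      chiInvDiff x = b ↔ b * (x * (x + 1)) = ε * (2 * x + 1) := by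
    rw [chiInvDiff, hx, hx1]
    push_cast
    have : (ε : F) * (x + 1)⁻¹ - -(ε : F) * x⁻¹ = ε * (2 * x + 1) / (x * (x + 1)) := by
      field_simp
      ring
    rw [this, div_eq_iff (mul_ne_zero h0 h1), eq_comm]
  have hne (ε : ℤ) (hε : ε ≠ 0) (y : F) (hy : quadraticChar F y = ε) : y ≠ 0 := by
    rintro rfl
    exact hε (by simpa using hy.symm)
  constructor
  · rintro ⟨h, hχ⟩
    rcases Int.mul_eq_neg_one_iff_eq_one_or_neg_one.mp hχ with ⟨h1, h2⟩ | ⟨h1, h2⟩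
    · right
      have := (key (-1) (hne _ one_ne_zero _ h1) (hne _ (by norm_num) _ h2) (by simpa using h1)
        h2).mp h
      exact ⟨by simpa using this, h1, h2⟩
    · left
      have := (key 1 (hne _ (by norm_num) _ h1) (hne _ one_ne_zero _ h2) h1 h2).mp h
      exact ⟨by simpa using this, h1, h2⟩
  · rintro (⟨h, h1, h2⟩ | ⟨h, h1, h2⟩)
    · exact ⟨(key 1 (hne _ (by norm_num) _ h1) (hne _ one_ne_zero _ h2) h1 h2).mpr
        (by simpa using h), by simp [h1, h2]⟩
    · exact ⟨(key (-1) (hne _ one_ne_zero _ h1) (hne _ (by norm_num) _ h2) (by simpa using h1)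
        h2).mpr (by simpa using h), by simp [h1, h2]⟩

/-- Among the two roots of `b x (x + 1) = 2 x + 1`, for a nonzero square `b`, the characters of
`x` differ and those of `x + 1` agree. -/
lemma quadraticChar_roots_mixed (hneg : quadraticChar F (-1) = -1) {b u v : F}
    (hb : quadraticChar F b = 1) (hu : b * (u * (u + 1)) = 2 * u + 1)
    (hv : b * (v * (v + 1)) = 2 * v + 1) (huv : u ≠ v) :
    quadraticChar F u = -quadraticChar F v ∧
      quadraticChar F (u + 1) = quadraticChar F (v + 1) := by
  have hsum : b * (u + v + 1) = 2 := by
    apply mul_left_cancel₀ (sub_ne_zero.mpr huv)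
    linear_combination hu - hv
  have hprod : b * (u * v) = -1 := by linear_combination u * hsum - hu
  have hprod' : b * ((u + 1) * (v + 1)) = 1 := by linear_combination hprod + hsum
  constructor
  · apply quadraticChar_eq_neg_of_mul_eq_neg_one
    rw [← hneg, ← hprod, map_mul _ b, hb, one_mul]
  · apply quadraticChar_eq_of_mul_eq_one
    rw [← one_mul (quadraticChar F _), ← hb, ← map_mul, hprod', map_one, hb]

lemma card_fibre_mixed (hF : ringChar F ≠ 2) (hneg : quadraticChar F (-1) = -1) {b : F}
    (hb : quadraticChar F b = 1) :
    #{x : F | chiInvDiff x = b ∧ quadraticChar F x * quadraticChar F (x + 1) = -1} =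
      if quadraticChar F (b ^ 2 + 4) = 1 then 1 else 0 := by
  have h2 : (2 : F) ≠ 0 := Ring.two_ne_zero hF
  have hb0 : b ≠ 0 := by rintro rfl; simp at hb
  simp only [mem_fibre_mixed_iff]
  have hD : b ^ 2 + 4 ≠ 0 := sq_add_four_ne_zero hF hneg hb0
  -- the reflected solutions satisfy the same quadratic equation
  have hrefl {x : F} (h : b * (x * (x + 1)) = -(2 * x + 1)) :
      b * ((-1 - x) * (-1 - x + 1)) = 2 * (-1 - x) + 1 := by linear_combination h
  split_ifs with h4
  · obtain ⟨s, hs⟩ := (quadraticChar_one_iff_isSquare hD).mp h4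
    have hs0 : s ≠ 0 := by rintro rfl; simp [hs] at hD
    have hroot (s : F) (hs : b ^ 2 + 4 = s * s) :
        b * ((2 - b + s) / (2 * b) * ((2 - b + s) / (2 * b) + 1)) =
          2 * ((2 - b + s) / (2 * b)) + 1 := by
      field_simp
      linear_combination -hs
    have hne : (2 - b + s) / (2 * b) ≠ (2 - b + -s) / (2 * b) := by
      intro h
      field_simp at h
      have : 2 * s = 0 := by linear_combination h
      exact mul_ne_zero h2 hs0 this
    have hroots : ∃ u v : F, b * (u * (u + 1)) = 2 * u + 1 ∧
        b * (v * (v + 1)) = 2 * v + 1 ∧ u ≠ v :=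
      ⟨_, _, hroot s hs, hroot (-s) (by rw [hs]; ring), hne⟩
    obtain ⟨u, v, hu, hv, huv⟩ := hroots
    have hχ := quadraticChar_roots_mixed hneg hb hu hv huv
    have hnz {x : F} (hx : b * (x * (x + 1)) = 2 * x + 1) : x ≠ 0 ∧ x + 1 ≠ 0 := by
      constructor
      · rintro rfl
        simp at hx
      · intro h
        rw [h] at hx
        exact one_ne_zero (by linear_combination hx + 2 * h : (1 : F) = 0)
    have hex : ∃ z : F, b * (z * (z + 1)) = 2 * z + 1 ∧
        quadraticChar F z = -quadraticChar F (z + 1) := by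
      rcases quadraticChar_dichotomy (hnz hu).1 with h | h <;>
      rcases quadraticChar_dichotomy (hnz hu).2 with h' | h'
      · exact ⟨v, hv, by omega⟩
      · exact ⟨u, hu, by omega⟩
      · exact ⟨u, hu, by omega⟩
      · exact ⟨v, hv, by omega⟩
    obtain ⟨z, hz, hzχ⟩ := hex
    have huniq {x : F} (hx : b * (x * (x + 1)) = 2 * x + 1)
        (hxχ : quadraticChar F x = -quadraticChar F (x + 1)) : x = z := by
      by_contra hxz
      have h := quadraticChar_roots_mixed hneg hb hx hz hxz
      apply (hnz hz).1
      rw [← quadraticChar_eq_zero_iff]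
      omega
    rw [card_eq_one]
    rcases quadraticChar_dichotomy (hnz hz).2 with h | h
    · refine ⟨z, ?_⟩
      ext x
      simp only [mem_filter, mem_univ, true_and, mem_singleton]
      constructor
      · rintro (⟨hx, h0, h1⟩ | ⟨hx, h0, h1⟩)
        · exact huniq hx (by omega)
        · have := huniq (hrefl hx) (by
            rw [quadraticChar_neg_one_sub hneg, quadraticChar_neg_one_sub_add_one hneg]
            omega)
          rw [← this, quadraticChar_neg_one_sub_add_one hneg] at h
          omega
      · rintro rfl
        exact Or.inl ⟨hz, by omega, h⟩
    · refine ⟨-1 - z, ?_⟩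
      ext x
      simp only [mem_filter, mem_univ, true_and, mem_singleton]
      constructor
      · rintro (⟨hx, h0, h1⟩ | ⟨hx, h0, h1⟩)
        · have := huniq hx (by omega)
          rw [this] at h1
          omega
        · have := huniq (hrefl hx) (by
            rw [quadraticChar_neg_one_sub hneg, quadraticChar_neg_one_sub_add_one hneg]
            omega)
          linear_combination -this
      · rintro rfl
        refine Or.inr ⟨by linear_combination hz, ?_, ?_⟩
        · rw [quadraticChar_neg_one_sub hneg, h, neg_neg]
        · rw [quadraticChar_neg_one_sub_add_one hneg, hzχ, h]
          rfl
  · rw [card_eq_zero, filter_eq_empty_iff]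
    have hnone {x : F} (hx : b * (x * (x + 1)) = 2 * x + 1) : False := by
      apply h4
      rw [quadraticChar_one_iff_isSquare hD]
      exact ⟨2 * b * x + b - 2, by linear_combination -4 * b * hx⟩
    rintro x - (⟨hx, -⟩ | ⟨hx, -⟩)
    · exact hnone hx
    · exact hnone (hrefl hx)

/-- The fibre of `chiInvDiff` over a nonzero square. -/
lemma card_fibre_of_quadraticChar_eq_one (hF : ringChar F ≠ 2)
    (hneg : quadraticChar F (-1) = -1) {b : F}
    (hb : quadraticChar F b = 1) :
    #{x : F | chiInvDiff x = b} = (if quadraticChar F (b + 4) = 1 then 1 else 0) +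
      (if quadraticChar F (b ^ 2 + 4) = 1 then 1 else 0) + if b = 1 then 1 else 0 := by
  rw [← card_fibre_same hF hneg hb, ← card_fibre_mixed hF hneg hb]
  have hzero : #{x : F | chiInvDiff x = b ∧ quadraticChar F x * quadraticChar F (x + 1) = 0} =
      if b = 1 then 1 else 0 := by
    have hiff (x : F) : (chiInvDiff x = b ∧ quadraticChar F x * quadraticChar F (x + 1) = 0) ↔
        x = 0 ∧ b = 1 := by
      rw [mul_eq_zero, quadraticChar_eq_zero_iff, quadraticChar_eq_zero_iff]
      constructor
      · rintro ⟨h, rfl | hx⟩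
        · exact ⟨rfl, by simpa [chiInvDiff] using h.symm⟩
        · exfalso
          obtain rfl : x = -1 := by linear_combination hx
          have : b = -1 := by
            rw [← h]
            simp [chiInvDiff, hneg]
          rw [this, hneg] at hb
          norm_num at hb
      · rintro ⟨rfl, rfl⟩
        simp [chiInvDiff]
    simp only [hiff]
    split_ifs with h <;> simp [h, filter_eq']
  rw [← hzero, ← card_union_of_disjoint, ← card_union_of_disjoint]
  · congr 1
    ext x
    simp only [mem_filter, mem_univ, true_and, mem_union, ← and_or_left, iff_self_and]
    intro _
    rcases quadraticChar_isQuadratic F (x * (x + 1)) with h | h | h <;> rw [map_mul] at h <;>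
      tauto
  all_goals
    rw [disjoint_left]
    intro x
    simp only [mem_filter, mem_univ, true_and, mem_union]
    grind

lemma card_fibre_zero (hF : ringChar F ≠ 2) (hneg : quadraticChar F (-1) = -1) :
    #{x : F | chiInvDiff x = 0} = 1 := by
  have h2 : (2 : F) ≠ 0 := Ring.two_ne_zero hF
  rw [card_eq_one]
  refine ⟨-1 / 2, ?_⟩
  ext x
  simp only [mem_filter, mem_univ, true_and, mem_singleton]
  constructor
  · intro h
    have hx : x ≠ 0 := by
      rintro rfl
      simp [chiInvDiff] at h
    have hx1 : x + 1 ≠ 0 := by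
      intro h0
      obtain rfl : x = -1 := by linear_combination h0
      simp [chiInvDiff, hneg] at h
    have hroot : 2 * x + 1 = 0 := by
      rcases quadraticChar_dichotomy (mul_ne_zero hx hx1) with hχ | hχ
      · exfalso
        have hχ' := quadraticChar_eq_of_mul_eq_one hχ
        have : (quadraticChar F x : F) * ((x + 1)⁻¹ - x⁻¹) = 0 := by
          rw [← h, chiInvDiff, ← hχ']
          ring
        rcases mul_eq_zero.mp this with h0 | h0
        · rcases quadraticChar_dichotomy hx with h' | h' <;> simp [h'] at h0
        · have h1 := inv_injective (sub_eq_zero.mp h0)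
          simp at h1
      · rw [map_mul] at hχ
        rcases (mem_fibre_mixed_iff 0 x).mp ⟨h, hχ⟩ with ⟨h0, -⟩ | ⟨h0, -⟩
        · linear_combination -h0
        · linear_combination h0
    field_simp
    linear_combination hroot
  · rintro rfl
    have h := chiInvDiff_neg_one_sub hneg (-1 / 2 : F)
    have h' : (-1 - -1 / 2 : F) = -1 / 2 := by field_simp; ring
    rw [h'] at h
    have : 2 * chiInvDiff (-1 / 2 : F) = 0 := by linear_combination h
    exact (mul_eq_zero.mp this).resolve_left h2

/-- If `5` is a nonsquare, the points `0` and `-1` never produce a third solution. -/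
lemma card_fibre_le_two_and_eq_two_iff (hF : ringChar F ≠ 2)
    (hneg : quadraticChar F (-1) = -1) (h5 : ¬ IsSquare (5 : F)) {b : F}
    (hb : quadraticChar F b = 1) :
    #{x : F | chiInvDiff x = b} ≤ 2 ∧
      (#{x : F | chiInvDiff x = b} = 2 ↔
        quadraticChar F (b + 4) = 1 ∧ quadraticChar F (b ^ 2 + 4) = 1) := by
  rw [card_fibre_of_quadraticChar_eq_one hF hneg hb]
  by_cases h : b = 1
  · subst h
    have h5' : quadraticChar F 5 = -1 := quadraticChar_neg_one_iff_not_isSquare.mpr h5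
    have e1 : (1 + 4 : F) = 5 := by norm_num
    simp [e1, h5', -quadraticChar_apply]
  · split_ifs <;> simp [*, -quadraticChar_apply]

lemma card_fibre_le_two (hF : ringChar F ≠ 2) (hneg : quadraticChar F (-1) = -1)
    (h5 : ¬ IsSquare (5 : F)) (b : F) : #{x : F | chiInvDiff x = b} ≤ 2 := by
  rcases eq_or_ne b 0 with rfl | hb
  · simp [card_fibre_zero hF hneg]
  rcases quadraticChar_dichotomy hb with h | h
  · exact (card_fibre_le_two_and_eq_two_iff hF hneg h5 h).1
  · rw [← card_fibre_neg hneg]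
    exact (card_fibre_le_two_and_eq_two_iff hF hneg h5
      (by rw [quadraticChar_neg hneg, h, neg_neg])).1

/-- The number of two-element fibres as a character sum. -/
lemma four_mul_card_fibre_eq_two (hF : ringChar F ≠ 2) (hneg : quadraticChar F (-1) = -1)
    (h5 : ¬ IsSquare (5 : F)) :
    4 * (#{b : F | #{x : F | chiInvDiff x = b} = 2} : ℤ) =
      ∑ b : F, (quadraticChar F b ^ 2 + quadraticChar F b) * (1 + quadraticChar F (b + 4)) *
        (1 + quadraticChar F (b ^ 2 + 4)) := by
  set h : F → ℤ := fun b => (quadraticChar F b ^ 2 + quadraticChar F b) *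
    (1 + quadraticChar F (b + 4)) * (1 + quadraticChar F (b ^ 2 + 4)) with hh
  set g : F → ℤ := fun b => if #{x : F | chiInvDiff x = b} = 2 then 4 else 0 with hg
  have hg_neg (b : F) : g (-b) = g b := by simp only [hg, card_fibre_neg hneg]
  have hone {b : F} (hb : quadraticChar F b = 1) : g b + g (-b) = h b + h (-b) := by
    have hb0 : b ≠ 0 := by rintro rfl; simp at hb
    have hb4 : b + 4 ≠ 0 := add_four_ne_zero hF hneg hb
    have hD : b ^ 2 + 4 ≠ 0 := sq_add_four_ne_zero hF hneg hb0
    rw [hg_neg]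
    simp only [hg, hh, (card_fibre_le_two_and_eq_two_iff hF hneg h5 hb).2,
      quadraticChar_neg hneg, hb]
    rcases quadraticChar_dichotomy hb4 with h | h <;>
    rcases quadraticChar_dichotomy hD with h' | h' <;> rw [h, h'] <;> norm_num
  have key (b : F) : g b + g (-b) = h b + h (-b) := by
    rcases eq_or_ne b 0 with rfl | hb
    · simp [hg, hh, card_fibre_zero hF hneg]
    rcases quadraticChar_dichotomy hb with hb | hb
    · exact hone hb
    · have := hone (b := -b) (by rw [quadraticChar_neg hneg, hb, neg_neg])
      rw [neg_neg] at this
      linarith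
  have hsum : ∑ b, (g b + g (Equiv.neg F b)) = ∑ b, (h b + h (Equiv.neg F b)) :=
    sum_congr rfl fun b _ => key b
  rw [sum_add_distrib, sum_add_distrib, Equiv.sum_comp (Equiv.neg F) g,
    Equiv.sum_comp (Equiv.neg F) h] at hsum
  have hcard : ∑ b, g b = 4 * (#{b : F | #{x : F | chiInvDiff x = b} = 2} : ℤ) := by
    simp only [hg]
    rw [← sum_filter, sum_const, nsmul_eq_mul, mul_comm]
  linarith

/-- Evaluation of the character sum counting the two-element fibres. -/
lemma sum_quadraticChar_product (hF : ringChar F ≠ 2) (hneg : quadraticChar F (-1) = -1) :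
    ∑ b : F, (quadraticChar F b ^ 2 + quadraticChar F b) * (1 + quadraticChar F (b + 4)) *
        (1 + quadraticChar F (b ^ 2 + 4)) =
      Fintype.card F + (∑ x : F, quadraticChar F (x * (x ^ 2 + 4 * x - 1)) +
        ∑ x : F, quadraticChar F (x * (x ^ 2 - 2 * x + 5))) - 7 := by
  have h2 : (2 : F) ≠ 0 := Ring.two_ne_zero hF
  have e4 : (4 : F) = 2 ^ 2 := by norm_num
  have h4 : (4 : F) ≠ 0 := e4 ▸ pow_ne_zero 2 h2
  have hχ4 : quadraticChar F 4 = 1 := by rw [e4, quadraticChar_sq_one' h2]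
  have hexp (b : F) : (quadraticChar F b ^ 2 + quadraticChar F b) *
      (1 + quadraticChar F (b + 4)) * (1 + quadraticChar F (b ^ 2 + 4)) =
      1 + quadraticChar F b + quadraticChar F (b + 4) + quadraticChar F (b * (b + 4)) +
      quadraticChar F (b ^ 2 - 4 * (-1)) + quadraticChar F (b * (b ^ 2 + 4)) +
      quadraticChar F ((b + 4) * (b ^ 2 - 4 * (-1))) +
      quadraticChar F (b * (b + 4) * (b ^ 2 + 4)) - if b = 0 then 4 else 0 := by
    have e : b ^ 2 - 4 * (-1) = b ^ 2 + 4 := by ring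
    rw [e]
    split_ifs with hb
    · subst hb
      simp [hχ4, quadraticChar_zero, -quadraticChar_apply]
    · rw [quadraticChar_sq_one hb]
      simp only [map_mul]
      ring
  have hshift : ∑ b : F, quadraticChar F (b + 4) = 0 := by
    rw [← quadraticChar_sum_zero hF]
    exact Equiv.sum_comp (Equiv.addRight (4 : F)) (fun u => quadraticChar F u)
  have hodd : ∑ b : F, quadraticChar F (b * (b ^ 2 + 4)) = 0 := by
    have h := Equiv.sum_comp (Equiv.neg F) (fun b => quadraticChar F (b * (b ^ 2 + 4)))
    simp only [Equiv.neg_apply, neg_sq, neg_mul, quadraticChar_neg hneg, sum_neg_distrib] at h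
    linarith
  have hiso : ∑ x : F, quadraticChar F (x * (x ^ 2 + 4 * x - 1)) =
      ∑ u : F, quadraticChar F ((u + 4) * (u ^ 2 - 4 * (-1))) := by
    simp only [sub_eq_add_neg (_ + _) (1 : F)]
    exact sum_quadraticChar_two_isogeny hF 4 (neg_ne_zero.mpr one_ne_zero)
  simp only [hexp, sum_sub_distrib, sum_add_distrib]
  rw [quadraticChar_sum_zero hF, hshift, sum_quadraticChar_mul_add hF h4,
    sum_quadraticChar_sq_sub hF (neg_ne_zero.mpr one_ne_zero), hodd, ← hiso,
    sum_quadraticChar_quartic hF, sum_ite_eq' univ (0 : F), if_pos (mem_univ _), sum_const,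
    card_univ, nsmul_eq_mul]
  ring

end Fibres

/-- Counting identities for a self-map of a finite set with fibres of size at most two. -/
lemma card_fibre_counts {α : Type*} [Fintype α] [DecidableEq α] (f : α → α)
    (hf : ∀ b, #{x | f x = b} ≤ 2) :
    #{b | #{x | f x = b} = 0} + #{b | #{x | f x = b} = 1} + #{b | #{x | f x = b} = 2} =
      Fintype.card α ∧
    #{b | #{x | f x = b} = 1} + 2 * #{b | #{x | f x = b} = 2} = Fintype.card α := by
  constructor
  · simp only [card_filter _ univ, ← sum_add_distrib]
    rw [← card_univ, card_eq_sum_ones]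
    refine sum_congr rfl fun b _ => ?_
    have := hf b
    simp only [card_filter] at this
    split_ifs <;> omega
  · rw [← card_univ,
      card_eq_sum_card_fiberwise (s := univ) (f := f) (t := univ) (fun _ _ => mem_univ _),
      card_filter, card_filter, mul_sum, ← sum_add_distrib]
    refine sum_congr rfl fun b _ => ?_
    have := hf b
    split_ifs <;> omega

theorem stmt_15 (F : Type*) [Field F] [Fintype F] [DecidableEq F]
    (hq3 : Fintype.card F % 4 = 3) (hq : 7 < Fintype.card F)
    (hq27 : Fintype.card F ≠ 27)
    (d : ℕ) (hd : d = (Fintype.card F - 3) / 2)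
    (h5 : ¬ IsSquare (5 : F))
    (lam : ℤ)
    (hlam : lam = (∑ x : F, quadraticChar F (x * (x ^ 2 + 4 * x - 1))) +
        ∑ x : F, quadraticChar F (x * (x ^ 2 - 2 * x + 5)))
    (ω : ℕ → ℕ)
    (hω : ∀ i, ω i = {b : F | {x : F | (x + 1) ^ d - x ^ d = b}.ncard = i}.ncard) :
    4 * (ω 0 : ℤ) = (Fintype.card F : ℤ) + lam - 7 ∧
    2 * (ω 1 : ℤ) = (Fintype.card F : ℤ) - lam + 7 ∧
    4 * (ω 2 : ℤ) = (Fintype.card F : ℤ) + lam - 7 ∧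
    ω 0 + ω 1 + ω 2 = Fintype.card F := by
  have hF : ringChar F ≠ 2 := by
    intro h
    have := FiniteField.even_card_of_char_two h
    omega
  have hneg : quadraticChar F (-1) = -1 := by
    rw [quadraticChar_neg_one_iff_not_isSquare, FiniteField.isSquare_neg_one_iff]
    exact not_not.mpr hq3
  have hω' (i : ℕ) : ω i = #{b : F | #{x : F | chiInvDiff x = b} = i} := by
    have hset (b : F) : {x : F | (x + 1) ^ d - x ^ d = b}.ncard =
        #{x : F | chiInvDiff x = b} := by
      rw [← Set.ncard_coe_finset]
      congr 1
      ext x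
      simp only [mem_coe, mem_filter, mem_univ, true_and]
      simp only [chiInvDiff, hd, pow_half_card_sub_three hF hq, Set.mem_ofPred_eq]
    rw [hω, ← Set.ncard_coe_finset]
    congr 1
    ext b
    simp [hset]
  obtain ⟨htotal, hweighted⟩ :=
    card_fibre_counts (chiInvDiff (F := F)) (card_fibre_le_two hF hneg h5)
  have htwo := four_mul_card_fibre_eq_two hF hneg h5
  rw [sum_quadraticChar_product hF hneg, ← hlam] at htwo
  simp only [← hω'] at htotal hweighted htwo
  omega
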